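/- Let d ≥ 2 and n ≥ 1, let μ = (μ₁ ≥ … ≥ μ_d ≥ 0) be a partition of n into at most d parts with μ₂ ≥ 1, let p ∈ [0,1], and set p*(μ) := 1/(1 + binom(n,μ)). Then the supremum, over all Hermitian matrices Π on (ℂ^d)^{⊗n} with 0 ⪯ Π ⪯ I, of the average success probability p·Tr[Π ρ_=^n] + (1−p)·(1 − Tr[Π ρ_≠^μ]) equals 1 − (1−p)/binom(n,μ) when p ≥ p*(μ), and equals 1 − p when p ≤ p*(μ). Moreover, the supremum is attained at Π = Π_{(n)} (the permutation test) in the first case and at Π = 0 (the trivial test that always outputs 'not equal') in the second case. -/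

import Mathlib

open MeasureTheory Matrix
open scoped ComplexOrder

noncomputable section

/-- The unitary group `U(d)`. -/
abbrev UG (d : ℕ) := Matrix.unitaryGroup (Fin d) ℂ

noncomputable instance (d : ℕ) : MeasurableSpace (UG d) := borel _

instance (d : ℕ) : BorelSpace (UG d) := ⟨rfl⟩

/-- The permutation matrix `ψ(π)` on `(ℂ^d)^{⊗n}`, with `(x,y)` entry `1` iff `y = x ∘ π`. -/
def psi (d n : ℕ) (π : Equiv.Perm (Fin n)) : Matrix (Fin n → Fin d) (Fin n → Fin d) ℂ :=
  Matrix.of fun x y => if y = x ∘ π then 1 else 0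

/-- The symmetrizer `Π_{(n)} = (1/n!) ∑_{π ∈ S_n} ψ(π)`. -/
def symmetrizer (d n : ℕ) : Matrix (Fin n → Fin d) (Fin n → Fin d) ℂ :=
  ((n.factorial : ℂ))⁻¹ • ∑ π : Equiv.Perm (Fin n), psi d n π

/-- The `n`-fold tensor power of a `d × d` matrix: `(U^{⊗n})_{x,y} = ∏ i, U_{x i, y i}`. -/
def tpow (d n : ℕ) (U : Matrix (Fin d) (Fin d) ℂ) :
    Matrix (Fin n → Fin d) (Fin n → Fin d) ℂ :=
  Matrix.of fun x y => ∏ i, U (x i) (y i)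

/-- The list consisting of `μ 0` copies of `0`, then `μ 1` copies of `1`, etc. -/
def wordList (d : ℕ) (μ : Fin d → ℕ) : List (Fin d) :=
  (List.ofFn fun i => List.replicate (μ i) i).flatten

lemma wordList_length (d : ℕ) (μ : Fin d → ℕ) : (wordList d μ).length = ∑ i, μ i := by
  simp [wordList, List.length_flatten, Function.comp, List.sum_ofFn]

/-- The word indexing the basis vector `|e_μ⟩`: the first `μ 0` tensor factors carry the
first basis label, the next `μ 1` factors the second basis label, etc. -/
def word (d n : ℕ) (μ : Fin d → ℕ) (hsum : ∑ i, μ i = n) (j : Fin n) : Fin d :=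
  (wordList d μ).get ⟨j, by rw [wordList_length, hsum]; exact j.isLt⟩

/-- `∫ U^{⊗n} |e_w⟩⟨e_w| (U^{⊗n})^† dq` for a basis word `w` (entrywise Bochner integral). -/
def rhoWord (d n : ℕ) (w : Fin n → Fin d) (q : Measure (UG d)) :
    Matrix (Fin n → Fin d) (Fin n → Fin d) ℂ :=
  Matrix.of fun x y =>
    ∫ U : UG d, tpow d n (U : Matrix (Fin d) (Fin d) ℂ) x w *
      star (tpow d n (U : Matrix (Fin d) (Fin d) ℂ) y w) ∂q

/-- The Haar-twirled unequal state `ρ_≠^μ`. -/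
def rhoNE (d n : ℕ) (μ : Fin d → ℕ) (hsum : ∑ i, μ i = n) (haar : Measure (UG d)) :
    Matrix (Fin n → Fin d) (Fin n → Fin d) ℂ :=
  rhoWord d n (word d n μ hsum) haar

/-- The partition `(n, 0, …, 0)`. -/
def muEq (d n : ℕ) (hd : 0 < d) : Fin d → ℕ := fun i => if i = ⟨0, hd⟩ then n else 0

lemma muEq_sum (d n : ℕ) (hd : 0 < d) : ∑ i, muEq d n hd i = n := by
  simp [muEq]

/-- The equal state `ρ_=^n = ρ_≠^{(n,0,…,0)}`. -/
def rhoEQ (d n : ℕ) (hd : 0 < d) (haar : Measure (UG d)) :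
    Matrix (Fin n → Fin d) (Fin n → Fin d) ℂ :=
  rhoNE d n (muEq d n hd) (muEq_sum d n hd) haar

/-- The set of POVM elements: Hermitian `P` with `0 ⪯ P ⪯ I`. -/
def POVMs (d n : ℕ) : Set (Matrix (Fin n → Fin d) (Fin n → Fin d) ℂ) :=
  {P | P.PosSemidef ∧ (1 - P).PosSemidef}

/-- The average success probability of the test `{P, I - P}` with prior `p` on the equal case. -/
def successProb (d n : ℕ) (hd : 0 < d) (μ : Fin d → ℕ) (hsum : ∑ i, μ i = n)
    (haar : Measure (UG d)) (p : ℝ) (P : Matrix (Fin n → Fin d) (Fin n → Fin d) ℂ) : ℝ :=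
  p * (Matrix.trace (P * rhoEQ d n hd haar)).re +
    (1 - p) * (1 - (Matrix.trace (P * rhoNE d n μ hsum haar)).re)

lemma tpow_mul (d n : ℕ) (A B : Matrix (Fin d) (Fin d) ℂ) :
    tpow d n (A * B) = tpow d n A * tpow d n B := by
  ext x y
  simp only [tpow, Matrix.of_apply, Matrix.mul_apply]
  rw [Finset.prod_univ_sum]
  simp [Finset.prod_mul_distrib]

lemma tpow_one (d n : ℕ) : tpow d n 1 = 1 := by
  ext x y
  simp only [tpow, Matrix.of_apply, Matrix.one_apply]
  by_cases h : x = y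
  · simp [h]
  · obtain ⟨i, hi⟩ := Function.ne_iff.mp h
    rw [if_neg h]
    exact Finset.prod_eq_zero (Finset.mem_univ i) (by simp [hi])

lemma tpow_star (d n : ℕ) (A : Matrix (Fin d) (Fin d) ℂ) :
    tpow d n (star A) = (tpow d n A)ᴴ := by
  ext x y
  simp [tpow, Matrix.star_apply, Matrix.conjTranspose_apply]

lemma tpow_star_mul (d n : ℕ) (V : UG d) :
    (tpow d n (V : Matrix (Fin d) (Fin d) ℂ))ᴴ * tpow d n (V : Matrix (Fin d) (Fin d) ℂ) = 1 := by
  rw [← tpow_star, ← tpow_mul, Matrix.UnitaryGroup.star_mul_self, tpow_one]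

lemma tpow_cont (d n : ℕ) (x y : Fin n → Fin d) :
    Continuous fun U : UG d => tpow d n (U : Matrix (Fin d) (Fin d) ℂ) x y := by
  simp only [tpow, Matrix.of_apply]
  refine continuous_finsetProd _ fun i _ => ?_
  exact (continuous_subtype_val).matrix_elem (x i) (y i)

lemma tpow_bound (d n : ℕ) (x y : Fin n → Fin d) (U : UG d) :
    ‖tpow d n (U : Matrix (Fin d) (Fin d) ℂ) x y‖ ≤ 1 := by
  simp only [tpow, Matrix.of_apply, norm_prod]
  exact Finset.prod_le_one (fun _ _ => norm_nonneg _)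
    (fun i _ => entry_norm_bound_of_unitary U.2 _ _)

lemma rho_int (d n : ℕ) (q : Measure (UG d)) [IsProbabilityMeasure q] (w x y : Fin n → Fin d) :
    Integrable (fun U : UG d => tpow d n (U : Matrix (Fin d) (Fin d) ℂ) x w *
      star (tpow d n (U : Matrix (Fin d) (Fin d) ℂ) y w)) q := by
  refine Integrable.of_bound (C := 1) ?_ (Filter.Eventually.of_forall fun U => ?_)
  · exact ((tpow_cont d n x w).mul (tpow_cont d n y w).star).aestronglyMeasurable
  · rw [norm_mul, norm_star]
    exact mul_le_one₀ (tpow_bound _ _ _ _ _) (norm_nonneg _) (tpow_bound _ _ _ _ _)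

lemma rho_sandwich (d n : ℕ) (q : Measure (UG d)) [IsProbabilityMeasure q] (w x y : Fin n → Fin d)
    (A B : Matrix (Fin n → Fin d) (Fin n → Fin d) ℂ) :
    (A * rhoWord d n w q * Bᴴ) x y = ∫ U : UG d, (A * tpow d n (U : Matrix (Fin d) (Fin d) ℂ)) x w *
      star ((B * tpow d n (U : Matrix (Fin d) (Fin d) ℂ)) y w) ∂q := by
  have e : ∀ U : UG d, (A * tpow d n (U : Matrix (Fin d) (Fin d) ℂ)) x w *
      star ((B * tpow d n (U : Matrix (Fin d) (Fin d) ℂ)) y w) =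
      ∑ j, ∑ i, (A x i * star (B y j)) * (tpow d n (U : Matrix (Fin d) (Fin d) ℂ) i w *
      star (tpow d n (U : Matrix (Fin d) (Fin d) ℂ) j w)) := by
    intro U
    simp only [Matrix.mul_apply, star_sum, star_mul', Finset.sum_mul_sum]
    rw [Finset.sum_comm]
    refine Finset.sum_congr rfl fun j _ => Finset.sum_congr rfl fun i _ => ?_
    ring
  simp_rw [e]
  rw [integral_finsetSum _ fun j _ => integrable_finsetSum _ fun i _ =>
    (rho_int d n q w i j).const_mul _]
  rw [Matrix.mul_apply]
  refine Finset.sum_congr rfl fun j _ => ?_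
  rw [integral_finsetSum _ fun i _ => (rho_int d n q w i j).const_mul _, Matrix.mul_apply,
    Finset.sum_mul]
  refine Finset.sum_congr rfl fun i _ => ?_
  rw [integral_const_mul]
  simp only [rhoWord, Matrix.of_apply, Matrix.conjTranspose_apply]
  ring

lemma rho_herm (d n : ℕ) (q : Measure (UG d)) (w : Fin n → Fin d) :
    (rhoWord d n w q)ᴴ = rhoWord d n w q := by
  ext x y
  simp only [rhoWord, Matrix.conjTranspose_apply, Matrix.of_apply]
  rw [Complex.star_def, ← integral_conj]
  congr 1
  ext U
  simp [mul_comm]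

lemma rho_psd (d n : ℕ) (q : Measure (UG d)) [IsProbabilityMeasure q] (w : Fin n → Fin d) :
    (rhoWord d n w q).PosSemidef := by
  refine .of_dotProduct_mulVec_nonneg (rho_herm d n q w) fun v => ?_
  have h := rho_sandwich d n q w w w (Matrix.of fun _ j => star (v j)) (Matrix.of fun _ j => star (v j))
  have e : star v ⬝ᵥ (rhoWord d n w q *ᵥ v) = ((Matrix.of fun _ j => star (v j)) * rhoWord d n w q *
    (Matrix.of fun (_ : Fin n → Fin d) j => star (v j))ᴴ) w w := by
    rw [Matrix.mul_assoc, Matrix.mul_apply]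
    simp [dotProduct, Matrix.mulVec, Matrix.mul_apply]
  rw [e, h]
  refine integral_nonneg fun U => ?_
  exact mul_star_self_nonneg _

lemma rho_comm (d n : ℕ) (q : Measure (UG d)) [IsProbabilityMeasure q]
    (hinv : ∀ V : UG d, Measure.map (fun U => V * U) q = q) (w : Fin n → Fin d) (V : UG d) :
    tpow d n (V : Matrix (Fin d) (Fin d) ℂ) * rhoWord d n w q =
      rhoWord d n w q * tpow d n (V : Matrix (Fin d) (Fin d) ℂ) := by
  set T := tpow d n (V : Matrix (Fin d) (Fin d) ℂ) with hT
  have h : T * rhoWord d n w q * Tᴴ = rhoWord d n w q := by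
    ext x y
    rw [rho_sandwich]
    simp only [hT, ← tpow_mul]
    conv_rhs => rw [← hinv V]
    simp only [rhoWord, Matrix.of_apply]
    rw [integral_map]
    · rfl
    · exact (continuous_const_mul V).measurable.aemeasurable
    · exact ((tpow_cont d n x w).mul (tpow_cont d n y w).star).aestronglyMeasurable
  conv_rhs => rw [← h]
  rw [Matrix.mul_assoc _ Tᴴ T, tpow_star_mul, Matrix.mul_one]

lemma psi_mul (d n : ℕ) (π : Equiv.Perm (Fin n)) (A : Matrix (Fin n → Fin d) (Fin n → Fin d) ℂ)
    (x y : Fin n → Fin d) : (psi d n π * A) x y = A (x ∘ π) y := by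
  simp [psi, Matrix.mul_apply]

lemma mul_psi (d n : ℕ) (π : Equiv.Perm (Fin n)) (A : Matrix (Fin n → Fin d) (Fin n → Fin d) ℂ)
    (x y : Fin n → Fin d) : (A * psi d n π) x y = A x (y ∘ π.symm) := by
  have : ∀ z : Fin n → Fin d, y = z ∘ π ↔ y ∘ π.symm = z := by
    intro z
    constructor
    · rintro rfl; ext; simp
    · rintro rfl; ext; simp
  simp [psi, Matrix.mul_apply, this]

lemma psi_tpow (d n : ℕ) (π : Equiv.Perm (Fin n)) (A : Matrix (Fin d) (Fin d) ℂ) :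
    psi d n π * tpow d n A = tpow d n A * psi d n π := by
  ext x y
  rw [psi_mul, mul_psi]
  simp only [tpow, Matrix.of_apply, Function.comp]
  rw [← Equiv.prod_comp π fun i => A (x i) (y (π.symm i))]
  simp

lemma sym_tpow (d n : ℕ) (A : Matrix (Fin d) (Fin d) ℂ) :
    symmetrizer d n * tpow d n A = tpow d n A * symmetrizer d n := by
  simp only [symmetrizer, Matrix.smul_mul, Matrix.mul_smul, Finset.sum_mul, Finset.mul_sum, psi_tpow]

lemma psi_sym (d n : ℕ) (π : Equiv.Perm (Fin n)) :
    psi d n π * symmetrizer d n = symmetrizer d n := by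
  ext x y
  rw [psi_mul]
  simp only [symmetrizer, Matrix.smul_apply, Matrix.sum_apply, psi, Matrix.of_apply]
  congr 1
  exact Equiv.sum_comp (Equiv.mulLeft π) (fun σ : Equiv.Perm (Fin n) => if y = x ∘ σ then (1 : ℂ) else 0)

lemma sym_mul_of (d n : ℕ) (A : Matrix (Fin n → Fin d) (Fin n → Fin d) ℂ)
    (h : ∀ π, psi d n π * A = A) : symmetrizer d n * A = A := by
  rw [symmetrizer, Matrix.smul_mul, Finset.sum_mul]
  simp only [h, Finset.sum_const, Finset.card_univ, Fintype.card_perm, Fintype.card_fin]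
  rw [← Nat.cast_smul_eq_nsmul ℂ, smul_smul, inv_mul_cancel₀, one_smul]
  exact_mod_cast n.factorial_ne_zero

lemma sym_idem (d n : ℕ) : symmetrizer d n * symmetrizer d n = symmetrizer d n :=
  sym_mul_of d n _ (psi_sym d n)

lemma sym_herm (d n : ℕ) : (symmetrizer d n)ᴴ = symmetrizer d n := by
  ext x y
  simp only [symmetrizer, Matrix.smul_apply, Matrix.sum_apply, psi, Matrix.of_apply,
    Matrix.conjTranspose_apply, smul_eq_mul, star_mul', star_sum]
  congr 1
  · simp
  · rw [← Equiv.sum_comp (Equiv.inv (Equiv.Perm (Fin n)))]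
    refine Finset.sum_congr rfl fun π _ => ?_
    have : x = y ∘ π.symm ↔ y = x ∘ π := by
      constructor
      · rintro rfl; ext; simp
      · rintro rfl; ext; simp
    by_cases h : y = x ∘ π
    · have h2 := this.2 h
      rw [if_pos h, if_pos (by exact h2)]; simp
    · rw [if_neg h, if_neg (by exact fun h' => h (this.1 h'))]; simp

lemma sym_mem (d n : ℕ) : symmetrizer d n ∈ POVMs d n := by
  constructor
  · have := posSemidef_conjTranspose_mul_self (symmetrizer d n)
    rwa [sym_herm, sym_idem] at this
  · have := posSemidef_conjTranspose_mul_self (1 - symmetrizer d n)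
    rwa [conjTranspose_sub, conjTranspose_one, sym_herm, Matrix.sub_mul, Matrix.one_mul, Matrix.mul_sub,
      sym_idem, Matrix.mul_one, sub_self, sub_zero] at this

lemma trace_psd {ι : Type*} [Fintype ι] [DecidableEq ι] (P A : Matrix ι ι ℂ)
    (hP : P.PosSemidef) (hA : A.PosSemidef) : 0 ≤ (Matrix.trace (P * A)).re := by
  obtain ⟨m, v, rfl⟩ := Matrix.posSemidef_iff_eq_sum_vecMulVec.mp hA
  rw [Finset.mul_sum, Matrix.trace_sum, Complex.re_sum]
  refine Finset.sum_nonneg fun i _ => ?_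
  rw [Matrix.mul_vecMulVec, Matrix.trace_vecMulVec, dotProduct_comm]
  exact (Complex.nonneg_iff.mp (hP.dotProduct_mulVec_nonneg (v i))).1

lemma trace_sym_rho (d n : ℕ) (q : Measure (UG d)) [IsProbabilityMeasure q] (w : Fin n → Fin d) :
    Matrix.trace (symmetrizer d n * rhoWord d n w q) = symmetrizer d n w w := by
  set S := symmetrizer d n with hS
  have h1 : ∀ U : UG d, ∑ x, (S * tpow d n (U : Matrix (Fin d) (Fin d) ℂ)) x w *
      star (((1 : Matrix (Fin n → Fin d) (Fin n → Fin d) ℂ) * tpow d n (U : Matrix (Fin d) (Fin d) ℂ)) x w) = S w w := by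
    intro U
    have : ((tpow d n (U : Matrix (Fin d) (Fin d) ℂ))ᴴ * (S * tpow d n (U : Matrix (Fin d) (Fin d) ℂ))) w w
        = S w w := by
      rw [hS, sym_tpow, ← Matrix.mul_assoc, tpow_star_mul, Matrix.one_mul]
    rw [← this, Matrix.mul_apply]
    refine Finset.sum_congr rfl fun x _ => ?_
    rw [Matrix.one_mul, Matrix.conjTranspose_apply, mul_comm]
  have h2 : Matrix.trace (S * rhoWord d n w q) =
      ∑ x, ∫ U : UG d, (S * tpow d n (U : Matrix (Fin d) (Fin d) ℂ)) x w *
      star (((1 : Matrix (Fin n → Fin d) (Fin n → Fin d) ℂ) * tpow d n (U : Matrix (Fin d) (Fin d) ℂ)) x w) ∂q := by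
    simp only [Matrix.trace, Matrix.diag_apply, ← rho_sandwich, Matrix.conjTranspose_one,
      Matrix.mul_one]
  rw [h2, ← integral_finsetSum]
  · simp only [h1]
    simp
  · intro x _
    refine Integrable.mono' (g := fun _ => ∑ i, ‖S x i‖) (integrable_const _) ?_ (Filter.Eventually.of_forall fun U => ?_)
    · refine Continuous.aestronglyMeasurable ?_
      simp only [Matrix.one_mul]
      simp only [Matrix.mul_apply]
      exact (continuous_finsetSum _ fun i _ => continuous_const.mul (tpow_cont d n i w)).mul
        (tpow_cont d n x w).star
    · rw [norm_mul, norm_star, Matrix.one_mul, Matrix.mul_apply]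
      refine (mul_le_of_le_one_right (norm_nonneg _) (tpow_bound _ _ _ _ _)).trans ?_
      refine (norm_sum_le _ _).trans (Finset.sum_le_sum fun i _ => ?_)
      rw [norm_mul]
      exact mul_le_of_le_one_right (norm_nonneg _) (tpow_bound _ _ _ _ _)

/-- The content (type) of a word. -/
def wtype (d n : ℕ) (x : Fin n → Fin d) : Fin d →₀ ℕ := ∑ i, Finsupp.single (x i) 1

lemma wtype_apply (d n : ℕ) (x : Fin n → Fin d) (a : Fin d) :
    wtype d n x a = Fintype.card {j // x j = a} := by
  simp [wtype, Finsupp.finsetSum_apply, Finsupp.single_apply, Fintype.card_subtype]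

lemma exists_perm (d n : ℕ) (x y : Fin n → Fin d) (h : wtype d n x = wtype d n y) :
    ∃ π : Equiv.Perm (Fin n), y = x ∘ π := by
  have e : ∀ a, Nonempty ({j // y j = a} ≃ {j // x j = a}) := fun a =>
    ⟨Fintype.equivOfCardEq (by rw [← wtype_apply, ← wtype_apply, h])⟩
  replace e := fun a => (e a).some
  refine ⟨(Equiv.sigmaFiberEquiv y).symm.trans ((Equiv.sigmaCongrRight e).trans
    (Equiv.sigmaFiberEquiv x)), ?_⟩
  ext j
  have := (e (y j) ⟨j, rfl⟩).2
  exact congrArg Fin.val this.symm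

lemma wtype_comp (d n : ℕ) (x : Fin n → Fin d) (π : Equiv.Perm (Fin n)) :
    wtype d n (x ∘ π) = wtype d n x :=
  Equiv.sum_comp π fun i => Finsupp.single (x i) 1

lemma sym_apply (d n : ℕ) (x z : Fin n → Fin d) :
    symmetrizer d n x z = if wtype d n x = wtype d n z then symmetrizer d n z z else 0 := by
  split_ifs with h
  · obtain ⟨π, rfl⟩ := exists_perm d n x z h
    conv_lhs => rw [← psi_sym d n π, psi_mul]
  · simp only [symmetrizer, Matrix.smul_apply, Matrix.sum_apply, psi, Matrix.of_apply]
    rw [Finset.sum_eq_zero, smul_zero]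
    intro π _
    rw [if_neg]
    rintro rfl
    exact h (wtype_comp d n x π).symm

lemma exists_unitary (d : ℕ) (z : Fin d) (v : EuclideanSpace ℂ (Fin d)) (hv : ‖v‖ = 1) :
    ∃ U : UG d, ∀ a, (U : Matrix (Fin d) (Fin d) ℂ) a z = v a := by
  have ho : Orthonormal ℂ (({z} : Set (Fin d)).domRestrict fun _ => v) := by
    constructor
    · intro i; simpa using hv
    · intro i j hij
      exact absurd (Subsingleton.elim i j) hij
  obtain ⟨b, hb⟩ := ho.exists_orthonormalBasis_extension_of_card_eq (by simp)
  have hU : (Matrix.of fun a i => b i a : Matrix (Fin d) (Fin d) ℂ) ∈ Matrix.unitaryGroup (Fin d) ℂ := by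
    rw [Matrix.mem_unitaryGroup_iff']
    ext i j
    have := orthonormal_iff_ite.mp b.orthonormal i j
    rw [PiLp.inner_apply] at this
    simp only [Matrix.mul_apply, Matrix.star_apply, Matrix.of_apply, Matrix.one_apply]
    rw [← this]
    refine Finset.sum_congr rfl fun a _ => ?_
    simp [mul_comm]
  refine ⟨⟨_, hU⟩, fun a => ?_⟩
  simp [hb z rfl]

lemma col_zero (d n : ℕ) (z : Fin d) (M : Matrix (Fin n → Fin d) (Fin n → Fin d) ℂ)
    (hM : ∀ V : UG d, tpow d n (V : Matrix (Fin d) (Fin d) ℂ) * M =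
      M * tpow d n (V : Matrix (Fin d) (Fin d) ℂ)) (x : Fin n → Fin d) (hx : x ≠ fun _ => z) :
    M x (fun _ => z) = 0 := by
  classical
  obtain ⟨ζ, hζ⟩ : ∃ ζ : ℂ, IsPrimitiveRoot ζ (n + 1) :=
    ⟨_, Complex.isPrimitiveRoot_exp (n + 1) (Nat.succ_ne_zero n)⟩
  have hnorm : ‖ζ‖ = 1 := hζ.norm'_eq_one (Nat.succ_ne_zero n)
  let D : Fin d → ℂ := fun a => if a = z then 1 else ζ
  have hD : ∀ a, star (D a) * D a = 1 := by
    intro a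
    have : ‖D a‖ = 1 := by simp only [D]; split_ifs <;> simp [hnorm]
    rw [Complex.star_def, ← Complex.normSq_eq_conj_mul_self, Complex.normSq_eq_norm_sq, this]; simp
  have hU : Matrix.diagonal D ∈ Matrix.unitaryGroup (Fin d) ℂ := by
    rw [Matrix.mem_unitaryGroup_iff', Matrix.star_eq_conjTranspose, Matrix.diagonal_conjTranspose,
      Matrix.diagonal_mul_diagonal, ← Matrix.diagonal_one]
    congr 1
    ext a
    exact hD a
  have ht : tpow d n (Matrix.diagonal D) = Matrix.diagonal fun x => ∏ i, D (x i) := by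
    ext x y
    simp only [tpow, Matrix.of_apply, Matrix.diagonal_apply]
    by_cases h : x = y
    · simp [h]
    · obtain ⟨i, hi⟩ := Function.ne_iff.mp h
      rw [if_neg h]
      exact Finset.prod_eq_zero (Finset.mem_univ i) (by simp [hi])
  have h := congrFun (congrFun (hM ⟨_, hU⟩) x) fun _ => z
  simp only [ht, Matrix.diagonal_mul, Matrix.mul_diagonal] at h
  have h1 : ∏ _i : Fin n, D z = 1 := by simp [D]
  have h2 : ∏ i, D (x i) ≠ 1 := by
    simp only [D, Finset.prod_ite, Finset.prod_const, one_pow, one_mul]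
    obtain ⟨i, hi⟩ := Function.ne_iff.mp hx
    refine hζ.pow_ne_one_of_pos_of_lt ?_ ?_
    · exact (Finset.card_pos.mpr ⟨i, by simpa using hi⟩).ne'
    · exact Nat.lt_succ_of_le ((Finset.card_le_univ _).trans (by simp))
  rw [h1, mul_one] at h
  by_contra h0
  exact h2 (mul_right_cancel₀ h0 (by rw [h, one_mul]))

lemma eig_unit (d n : ℕ) (z : Fin d) (M : Matrix (Fin n → Fin d) (Fin n → Fin d) ℂ)
    (hM : ∀ V : UG d, tpow d n (V : Matrix (Fin d) (Fin d) ℂ) * M =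
      M * tpow d n (V : Matrix (Fin d) (Fin d) ℂ))
    (v : EuclideanSpace ℂ (Fin d)) (hv : ‖v‖ = 1) (x : Fin n → Fin d) :
    ∑ y, M x y * ∏ i, v (y i) = M (fun _ => z) (fun _ => z) * ∏ i, v (x i) := by
  obtain ⟨U, hU⟩ := exists_unitary d z v hv
  have h := congrFun (congrFun (hM U) x) fun _ => z
  rw [Matrix.mul_apply, Matrix.mul_apply, Finset.sum_eq_single fun _ => z] at h
  · simp only [tpow, Matrix.of_apply, hU] at h
    rw [← h, mul_comm]
  · intro y _ hy
    rw [col_zero d n z M hM y hy, mul_zero]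
  · simp

lemma eig_all (d n : ℕ) (hn : 1 ≤ n) (z : Fin d) (M : Matrix (Fin n → Fin d) (Fin n → Fin d) ℂ)
    (hM : ∀ V : UG d, tpow d n (V : Matrix (Fin d) (Fin d) ℂ) * M =
      M * tpow d n (V : Matrix (Fin d) (Fin d) ℂ))
    (v : Fin d → ℂ) (x : Fin n → Fin d) :
    ∑ y, M x y * ∏ i, v (y i) = M (fun _ => z) (fun _ => z) * ∏ i, v (x i) := by
  by_cases h0 : v = 0
  · subst h0
    have : n ≠ 0 := by omega
    simp [this]
  · set u : EuclideanSpace ℂ (Fin d) := WithLp.toLp 2 v with hu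
    have hu0 : u ≠ 0 := by
      intro h
      apply h0
      have := congrArg WithLp.ofLp h
      simpa [hu] using this
    have hr : (‖u‖ : ℂ) ≠ 0 := by exact_mod_cast norm_ne_zero_iff.mpr hu0
    have h := eig_unit d n z M hM ((‖u‖ : ℂ)⁻¹ • u) (by
      rw [norm_smul, norm_inv, Complex.norm_real, norm_norm, inv_mul_cancel₀ (norm_ne_zero_iff.mpr hu0)]) x
    simp only [PiLp.smul_apply, smul_eq_mul, Finset.prod_mul_distrib, Finset.prod_const] at h
    have hk : ((‖u‖ : ℂ)⁻¹) ^ (Finset.univ : Finset (Fin n)).card ≠ 0 := pow_ne_zero _ (inv_ne_zero hr)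
    apply mul_left_cancel₀ hk
    rw [Finset.mul_sum]
    calc _ = _ := Finset.sum_congr rfl fun y _ => by rw [mul_left_comm]
      _ = _ := h
      _ = _ := by rw [mul_left_comm]

lemma schur_sym (d n : ℕ) (hn : 1 ≤ n) (z : Fin d) (M : Matrix (Fin n → Fin d) (Fin n → Fin d) ℂ)
    (hM : ∀ V : UG d, tpow d n (V : Matrix (Fin d) (Fin d) ℂ) * M =
      M * tpow d n (V : Matrix (Fin d) (Fin d) ℂ)) :
    ∃ c : ℂ, M * symmetrizer d n = c • symmetrizer d n := by
  refine ⟨M (fun _ => z) (fun _ => z), ?_⟩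
  set c := M (fun _ => z) (fun _ => z) with hc
  have mono : ∀ (k : ℂ) (y : Fin n → Fin d),
      MvPolynomial.monomial (wtype d n y) k = MvPolynomial.C k * ∏ i, MvPolynomial.X (y i) := by
    intro k y
    rw [wtype, MvPolynomial.monomial_sum_index]
    rfl
  have hpoly : ∀ x, ∑ y, MvPolynomial.monomial (wtype d n y) (M x y) =
      MvPolynomial.monomial (wtype d n x) c := by
    intro x
    apply MvPolynomial.funext
    intro v
    simp only [mono, map_sum, map_mul, MvPolynomial.eval_C, map_prod, MvPolynomial.eval_X]
    exact eig_all d n hn z M hM v x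
  ext x t
  have h := congrArg (MvPolynomial.coeff (wtype d n t)) (hpoly x)
  rw [MvPolynomial.coeff_sum] at h
  simp only [MvPolynomial.coeff_monomial] at h
  rw [Matrix.mul_apply, Matrix.smul_apply, sym_apply d n x t]
  calc _ = (∑ y, if wtype d n y = wtype d n t then M x y else 0) * symmetrizer d n t t := by
        rw [Finset.sum_mul]
        exact Finset.sum_congr rfl fun y _ => by rw [sym_apply d n y t]; split_ifs <;> simp
    _ = _ := by rw [h]; split_ifs <;> simp

lemma ofFn_word (d n : ℕ) (μ : Fin d → ℕ) (hsum : ∑ i, μ i = n) :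
    List.ofFn (word d n μ hsum) = wordList d μ := by
  apply List.ext_getElem
  · simp [wordList_length, hsum]
  · intro i h1 h2
    simp [word]

lemma card_word (d n : ℕ) (μ : Fin d → ℕ) (hsum : ∑ i, μ i = n) (a : Fin d) :
    Fintype.card {j // word d n μ hsum j = a} = μ a := by
  have h1 : (wordList d μ).count a = μ a := by
    simp [wordList, List.count_flatten, List.sum_ofFn, Function.comp, List.count_replicate]
  rw [← h1, ← ofFn_word d n μ hsum, ← Multiset.coe_count, ← Fin.univ_val_map, Multiset.count_map,
    Fintype.card_subtype]
  simp only [Finset.card, Finset.filter_val, eq_comm]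

lemma sym_word (d n : ℕ) (μ : Fin d → ℕ) (hsum : ∑ i, μ i = n) :
    symmetrizer d n (word d n μ hsum) (word d n μ hsum) = ((Nat.multinomial Finset.univ μ : ℂ))⁻¹ := by
  set w := word d n μ hsum with hw
  have h := DomMulAct.stabilizer_card w
  simp only [hw, card_word] at h
  rw [← hw] at h
  have h2 := Nat.multinomial_spec Finset.univ μ
  rw [hsum, ← h, Fintype.card_subtype] at h2
  simp only [symmetrizer, Matrix.smul_apply, Matrix.sum_apply, psi, Matrix.of_apply, smul_eq_mul,
    Finset.sum_boole]
  simp only [eq_comm (a := w)]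
  have h3 : (n.factorial : ℂ) ≠ 0 := by exact_mod_cast n.factorial_ne_zero
  rw [← h2] at h3 ⊢
  push_cast at h3 ⊢
  have := left_ne_zero_of_mul h3
  rw [mul_inv, mul_right_comm, inv_mul_cancel₀ this, one_mul]

lemma word_muEq (d n : ℕ) (hd : 0 < d) :
    word d n (muEq d n hd) (muEq_sum d n hd) = fun _ => ⟨0, hd⟩ := by
  ext1 j
  by_contra h
  have := card_word d n (muEq d n hd) (muEq_sum d n hd) (word d n (muEq d n hd) (muEq_sum d n hd) j)
  rw [muEq, if_neg h, Fintype.card_eq_zero_iff] at this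
  exact this.false ⟨j, rfl⟩

lemma sym_rhoEQ (d n : ℕ) (hd : 0 < d) (q : Measure (UG d)) :
    symmetrizer d n * rhoEQ d n hd q = rhoEQ d n hd q := by
  apply sym_mul_of
  intro π
  ext x y
  rw [psi_mul]
  simp only [rhoEQ, rhoNE, rhoWord, word_muEq, Matrix.of_apply]
  have : ∀ U : UG d, tpow d n (U : Matrix (Fin d) (Fin d) ℂ) (x ∘ π) (fun _ => ⟨0, hd⟩) =
      tpow d n (U : Matrix (Fin d) (Fin d) ℂ) x (fun _ => ⟨0, hd⟩) := fun U =>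
    Equiv.prod_comp π fun i => (U : Matrix (Fin d) (Fin d) ℂ) (x i) ⟨0, hd⟩
  simp only [this]

lemma rhoEQ_trace (d n : ℕ) (hd : 0 < d) (q : Measure (UG d)) [IsProbabilityMeasure q] :
    Matrix.trace (rhoEQ d n hd q) = 1 := by
  rw [← sym_rhoEQ]
  simp only [rhoEQ, rhoNE]
  rw [trace_sym_rho, word_muEq]
  simp only [symmetrizer, Matrix.smul_apply, Matrix.sum_apply, psi, Matrix.of_apply]
  have : ∀ π : Equiv.Perm (Fin n), (fun _ : Fin n => (⟨0, hd⟩ : Fin d)) = (fun _ => ⟨0, hd⟩) ∘ π :=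
    fun π => rfl
  simp only [← this]
  simp [Fintype.card_perm, Nat.factorial_ne_zero]

lemma key_psd (d n : ℕ) (hd : 0 < d) (hn : 1 ≤ n) (μ : Fin d → ℕ) (hsum : ∑ i, μ i = n)
    (q : Measure (UG d)) [IsProbabilityMeasure q]
    (hinv : ∀ V : UG d, Measure.map (fun U => V * U) q = q) :
    (rhoNE d n μ hsum q - ((Nat.multinomial Finset.univ μ : ℂ))⁻¹ • rhoEQ d n hd q).PosSemidef := by
  set S := symmetrizer d n with hS
  set N : ℂ := (Nat.multinomial Finset.univ μ : ℂ)
  have hSh : Sᴴ = S := sym_herm d n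
  have hSS : S * S = S := sym_idem d n
  obtain ⟨c, hc⟩ := schur_sym d n hn ⟨0, hd⟩ (rhoEQ d n hd q) (rho_comm d n q hinv _)
  obtain ⟨k, hk⟩ := schur_sym d n hn ⟨0, hd⟩ (rhoNE d n μ hsum q) (rho_comm d n q hinv _)
  rw [← hS] at hc hk
  have hEQh : (rhoEQ d n hd q)ᴴ = rhoEQ d n hd q := rho_herm _ _ _ _
  have hNEh : (rhoNE d n μ hsum q)ᴴ = rhoNE d n μ hsum q := rho_herm _ _ _ _
  have hE : rhoEQ d n hd q = c • S := by
    have := congrArg Matrix.conjTranspose (sym_rhoEQ d n hd q)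
    rw [Matrix.conjTranspose_mul, hEQh, ← hS, hSh] at this
    rw [← this, hc]
  have t1 : c * S.trace = 1 := by
    rw [← rhoEQ_trace d n hd q, hE, Matrix.trace_smul, smul_eq_mul]
  have t2 : k * S.trace = N⁻¹ := by
    rw [← sym_word d n μ hsum, ← trace_sym_rho d n q, Matrix.trace_mul_comm]
    change _ = Matrix.trace (rhoNE d n μ hsum q * S)
    rw [hk, Matrix.trace_smul, smul_eq_mul]
  have hkc : N⁻¹ * c = k := by
    rw [← t2, mul_assoc, mul_comm S.trace, t1, mul_one]
  have hcomm : S * rhoNE d n μ hsum q = star k • S := by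
    have := congrArg Matrix.conjTranspose hk
    rwa [Matrix.conjTranspose_mul, hNEh, Matrix.conjTranspose_smul, hSh] at this
  have hp : (rhoNE d n μ hsum q).PosSemidef := rho_psd d n q _
  have h := hp.conjTranspose_mul_mul_same (1 - S)
  convert h using 1
  rw [hE, smul_smul, hkc, Matrix.conjTranspose_sub, Matrix.conjTranspose_one, hSh, Matrix.sub_mul, hcomm]
  simp only [Matrix.mul_sub, Matrix.sub_mul, Matrix.one_mul, Matrix.mul_one, hk, Matrix.smul_mul, hSS]
  abel

/-- Optimality of the permutation test for `QSI_μ^p`: for `p ≥ p*(μ)` the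
optimum of the primal SDP is `1 - (1-p)/binom(n,μ)`, attained by the permutation test
`Π_{(n)}`; for `p ≤ p*(μ)` the optimum is `1 - p`, attained by the trivial test `P = 0`. -/
theorem permutation_test_optimal_general (d n : ℕ) (hd : 2 ≤ d) (hn : 1 ≤ n)
    (μ : Fin d → ℕ) (hmono : ∀ i j : Fin d, i ≤ j → μ j ≤ μ i) (hsum : ∑ i, μ i = n)
    (hμ2 : 1 ≤ μ ⟨1, by omega⟩)
    (p : ℝ) (hp0 : 0 ≤ p) (hp1 : p ≤ 1)
    (haar : Measure (UG d)) [IsProbabilityMeasure haar]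
    (hinv : ∀ V : UG d, Measure.map (fun U => V * U) haar = haar) :
    symmetrizer d n ∈ POVMs d n ∧ (0 : Matrix (Fin n → Fin d) (Fin n → Fin d) ℂ) ∈ POVMs d n ∧
    (1 / (1 + (Nat.multinomial Finset.univ μ : ℝ)) ≤ p →
      sSup (successProb d n (by omega) μ hsum haar p '' POVMs d n)
          = 1 - (1 - p) / (Nat.multinomial Finset.univ μ : ℝ) ∧
      successProb d n (by omega) μ hsum haar p (symmetrizer d n)
          = 1 - (1 - p) / (Nat.multinomial Finset.univ μ : ℝ)) ∧
    (p ≤ 1 / (1 + (Nat.multinomial Finset.univ μ : ℝ)) →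
      sSup (successProb d n (by omega) μ hsum haar p '' POVMs d n) = 1 - p ∧
      successProb d n (by omega) μ hsum haar p 0 = 1 - p) := by
  have hd0 : 0 < d := by omega
  set N : ℝ := (Nat.multinomial Finset.univ μ : ℝ) with hN
  have hNpos : 0 < N := by
    rw [hN]; exact_mod_cast Nat.multinomial_pos Finset.univ μ
  have h0 : (0 : Matrix (Fin n → Fin d) (Fin n → Fin d) ℂ) ∈ POVMs d n := by
    refine ⟨PosSemidef.zero, ?_⟩
    rw [sub_zero]; exact PosSemidef.one
  have hb : ∀ P ∈ POVMs d n, ∃ a, 0 ≤ a ∧ a ≤ 1 ∧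
      successProb d n hd0 μ hsum haar p P ≤ p * a + (1 - p) * (1 - a / N) := by
    intro P hP
    have hEpsd : (rhoEQ d n hd0 haar).PosSemidef := rho_psd d n haar _
    refine ⟨(Matrix.trace (P * rhoEQ d n hd0 haar)).re, trace_psd _ _ hP.1 hEpsd, ?_, ?_⟩
    · have := trace_psd _ _ hP.2 hEpsd
      rw [Matrix.sub_mul, Matrix.one_mul, Matrix.trace_sub, rhoEQ_trace, Complex.sub_re,
        Complex.one_re] at this
      linarith
    · have := trace_psd _ _ hP.1 (key_psd d n hd0 hn μ hsum haar hinv)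
      rw [Matrix.mul_sub, Matrix.mul_smul, Matrix.trace_sub, Matrix.trace_smul, Complex.sub_re,
        smul_eq_mul, show ((Nat.multinomial Finset.univ μ : ℂ))⁻¹ = ((N⁻¹ : ℝ) : ℂ) by simp [hN],
        Complex.re_ofReal_mul] at this
      unfold successProb
      have h2 : 0 ≤ 1 - p := by linarith
      have := mul_nonneg h2 this
      rw [div_eq_inv_mul]
      linarith
  have hs : successProb d n hd0 μ hsum haar p (symmetrizer d n) = 1 - (1 - p) / N := by
    unfold successProb
    rw [sym_rhoEQ, rhoEQ_trace, rhoNE, trace_sym_rho, sym_word,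
      show ((Nat.multinomial Finset.univ μ : ℂ))⁻¹ = ((N⁻¹ : ℝ) : ℂ) by simp [hN],
      Complex.ofReal_re, Complex.one_re]
    ring
  have hz : successProb d n hd0 μ hsum haar p 0 = 1 - p := by
    simp [successProb]
  refine ⟨sym_mem d n, h0, fun hp => ⟨?_, hs⟩, fun hp => ⟨?_, hz⟩⟩
  · refine IsGreatest.csSup_eq ⟨⟨_, sym_mem d n, hs⟩, ?_⟩
    rintro _ ⟨P, hP, rfl⟩
    obtain ⟨a, ha0, ha1, h⟩ := hb P hP
    refine h.trans ?_
    rw [div_le_iff₀ (by linarith)] at hp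
    have h3 : (1 - p) / N ≤ p := by rw [div_le_iff₀ hNpos]; linarith
    have : (1 - p) * (1 - a / N) = (1 - p) - a * ((1 - p) / N) := by ring
    rw [this]
    nlinarith
  · refine IsGreatest.csSup_eq ⟨⟨_, h0, hz⟩, ?_⟩
    rintro _ ⟨P, hP, rfl⟩
    obtain ⟨a, ha0, ha1, h⟩ := hb P hP
    refine h.trans ?_
    rw [le_div_iff₀ (by linarith)] at hp
    have h3 : p ≤ (1 - p) / N := by rw [le_div_iff₀ hNpos]; linarith
    have : (1 - p) * (1 - a / N) = (1 - p) - a * ((1 - p) / N) := by ring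
    rw [this]
    nlinarith

end
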